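/- arXiv:2403.07031 — 3 statements merged into one kernel-verified Lean document; each statement's English description precedes it below -/
import Mathlib

section
/- Let α > 1 be a real constant. Then lim_{T→∞} T · Σ_{t=1}^{T−1} 1/(t^α (T−t)) = Σ_{t=1}^{∞} t^{−α} (which is finite). -/
open Filter

/-- A sum over `1 ≤ t < T` folded about its midpoint. -/
lemma sum_Ico_one_eq_sum_fold (f : ℕ → ℝ) (T : ℕ) :
    ∑ t ∈ Finset.Ico 1 T, f t =
      ∑ t ∈ Finset.Ico 1 T,
        ((if 2 * t ≤ T then f t else 0) + (if 2 * t < T then f (T - t) else 0)) := by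
  have hreflect : ∑ t ∈ Finset.Ico 1 T, (if 2 * t < T then f (T - t) else 0) =
      ∑ t ∈ Finset.Ico 1 T, (if 2 * t ≤ T then 0 else f t) := by
    refine Finset.sum_bij' (fun t _ => T - t) (fun t _ => T - t) ?_ ?_ ?_ ?_ ?_
    · intro t ht
      simp only [Finset.mem_Ico] at ht ⊢
      omega
    · intro t ht
      simp only [Finset.mem_Ico] at ht ⊢
      omega
    · intro t ht
      simp only [Finset.mem_Ico] at ht
      omega
    · intro t ht
      simp only [Finset.mem_Ico] at ht
      omega
    · intro t ht
      simp only [Finset.mem_Ico] at ht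
      by_cases h : 2 * t < T
      · rw [if_pos h, if_neg (by omega)]
      · rw [if_neg h, if_pos (by omega)]
  rw [Finset.sum_add_distrib, hreflect, ← Finset.sum_add_distrib]
  refine Finset.sum_congr rfl fun t _ => ?_
  split_ifs <;> simp

lemma div_rpow_mul_sub_le {α x y : ℝ} (hx : 0 < x) (h : 2 * x ≤ y) :
    y / (x ^ α * (y - x)) ≤ 2 * (1 / x ^ α) := by
  have hxα : 0 < x ^ α := Real.rpow_pos_of_pos hx α
  have hyx : 0 < y - x := by linarith
  rw [mul_one_div, div_le_div_iff₀ (mul_pos hxα hyx) hxα]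
  nlinarith

lemma div_sub_rpow_mul_le {α x y : ℝ} (hα : 1 ≤ α) (hx : 0 < x) (h : 2 * x ≤ y) :
    y / ((y - x) ^ α * x) ≤ 2 * (1 / x ^ α) := by
  have hyx : 0 < y - x := by linarith
  have hpow {z : ℝ} (hz : 0 < z) : z ^ α = z ^ (α - 1) * z := by
    rw [← Real.rpow_add_one hz.ne', sub_add_cancel]
  have hle : x ^ (α - 1) ≤ (y - x) ^ (α - 1) :=
    Real.rpow_le_rpow hx.le (by linarith) (by linarith)
  have hxα : 0 < x ^ (α - 1) := Real.rpow_pos_of_pos hx _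
  have hyα : 0 < (y - x) ^ (α - 1) := Real.rpow_pos_of_pos hyx _
  rw [hpow hx, hpow hyx, mul_one_div, div_le_div_iff₀ (by positivity) (by positivity)]
  calc y * (x ^ (α - 1) * x) ≤ (2 * (y - x)) * ((y - x) ^ (α - 1) * x) := by
        gcongr
        linarith
    _ = 2 * ((y - x) ^ (α - 1) * (y - x) * x) := by ring

lemma tendsto_div_sub_atTop (x : ℝ) :
    Tendsto (fun y : ℝ => y / (y - x)) atTop (nhds 1) := by
  have h : Tendsto (fun y : ℝ => 1 + x * (y - x)⁻¹) atTop (nhds (1 + x * 0)) :=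
    ((tendsto_inv_atTop_zero.comp
      (tendsto_atTop_add_const_right atTop (-x) tendsto_id)).const_mul x).const_add 1
  rw [mul_zero, add_zero] at h
  refine h.congr' ?_
  filter_upwards [eventually_gt_atTop x] with y hy
  have : y - x ≠ 0 := (sub_pos.2 hy).ne'
  field_simp
  ring

lemma tendsto_div_rpow_mul_sub (α x : ℝ) :
    Tendsto (fun y : ℝ => y / (x ^ α * (y - x))) atTop (nhds (1 / x ^ α)) := by
  have h := (tendsto_div_sub_atTop x).const_mul (1 / x ^ α)
  rw [mul_one] at h
  refine h.congr fun y => ?_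
  rw [div_mul_div_comm, one_mul]

lemma tendsto_div_sub_rpow_mul {α : ℝ} (hα : 1 < α) (x : ℝ) :
    Tendsto (fun y : ℝ => y / ((y - x) ^ α * x)) atTop (nhds 0) := by
  have hpow : Tendsto (fun y : ℝ => (y - x) ^ (-(α - 1))) atTop (nhds 0) :=
    (tendsto_rpow_neg_atTop (sub_pos.2 hα)).comp
      (tendsto_atTop_add_const_right atTop (-x) tendsto_id)
  have h := ((tendsto_div_sub_atTop x).mul hpow).mul_const x⁻¹
  rw [mul_zero, zero_mul] at h
  refine h.congr' ?_
  filter_upwards [eventually_gt_atTop x] with y hy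
  have hyx : 0 < y - x := sub_pos.2 hy
  have hα' : (y - x) ^ α = (y - x) ^ (α - 1) * (y - x) := by
    rw [← Real.rpow_add_one hyx.ne', sub_add_cancel]
  rw [Real.rpow_neg hyx.le, hα']
  simp only [div_eq_mul_inv, mul_inv]
  ring

/-- **Lemma 3, case `α > 1`.** `T · Σ_{t=1}^{T−1} 1/(t^α (T−t)) → Σ_{t=1}^∞ t^{−α}`,
which is finite (the series is summable). -/
theorem lemma3_alpha_gt_one (α : ℝ) (hα : 1 < α) :
    Summable (fun t : ℕ => 1 / ((t : ℝ) + 1) ^ α) ∧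
    Tendsto (fun T : ℕ =>
        (T : ℝ) * ∑ t ∈ Finset.Ico 1 T, 1 / ((t : ℝ) ^ α * ((T : ℝ) - (t : ℝ))))
      atTop (nhds (∑' t : ℕ, 1 / ((t : ℝ) + 1) ^ α)) := by
  have hα0 : α ≠ 0 := by linarith
  have hs : Summable (fun t : ℕ => 1 / (t : ℝ) ^ α) := Real.summable_one_div_nat_rpow.2 hα
  refine ⟨by simpa using (summable_nat_add_iff 1).2 hs, ?_⟩
  have htsum : ∑' t : ℕ, 1 / ((t : ℝ) + 1) ^ α = ∑' t : ℕ, 1 / (t : ℝ) ^ α := by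
    rw [hs.tsum_eq_zero_add]
    simp [Real.zero_rpow hα0]
  rw [htsum]
  let F : ℕ → ℕ → ℝ := fun T t =>
    (if 2 * t ≤ T then (T : ℝ) / ((t : ℝ) ^ α * ((T : ℝ) - t)) else 0) +
    (if 2 * t < T then (T : ℝ) / (((T : ℝ) - t) ^ α * t) else 0)
  have hF0 (T : ℕ) : F T 0 = 0 := by simp [F, Real.zero_rpow hα0]
  have hsum (T : ℕ) : ∑' t, F T t =
      (T : ℝ) * ∑ t ∈ Finset.Ico 1 T, 1 / ((t : ℝ) ^ α * ((T : ℝ) - (t : ℝ))) := by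
    rw [tsum_eq_sum (s := Finset.Ico 1 T), Finset.mul_sum,
      sum_Ico_one_eq_sum_fold
        (fun t => (T : ℝ) * (1 / ((t : ℝ) ^ α * ((T : ℝ) - (t : ℝ)))))]
    · refine Finset.sum_congr rfl fun t ht => ?_
      rw [Finset.mem_Ico] at ht
      simp only [F, mul_one_div, Nat.cast_sub ht.2.le, sub_sub_cancel]
    · intro t ht
      rw [Finset.mem_Ico] at ht
      rcases Nat.eq_zero_or_pos t with rfl | ht0
      · exact hF0 T
      · simp only [F]
        rw [if_neg (by omega), if_neg (by omega), add_zero]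
  have key : Tendsto (fun T => ∑' t, F T t) atTop (nhds (∑' t : ℕ, 1 / (t : ℝ) ^ α)) := by
    refine tendsto_tsum_of_dominated_convergence (hs.mul_left 4) (fun t => ?_)
      (Eventually.of_forall fun T t => ?_)
    · have h := ((tendsto_div_rpow_mul_sub α t).add (tendsto_div_sub_rpow_mul hα t)).comp
        (tendsto_natCast_atTop_atTop (R := ℝ))
      rw [add_zero] at h
      refine h.congr' ?_
      filter_upwards [eventually_gt_atTop (2 * t)] with T hT
      simp only [F, Function.comp_apply]
      rw [if_pos hT.le, if_pos hT]
    · rcases Nat.eq_zero_or_pos t with rfl | ht0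
      · rw [hF0, norm_zero]
        positivity
      · have ht : (0 : ℝ) < t := Nat.cast_pos.2 ht0
        have hpos : 0 < 1 / (t : ℝ) ^ α := by positivity
        have hbound {c : Prop} [Decidable c] (hc : c → 2 * t ≤ T) {a : ℝ}
            (ha : 2 * (t : ℝ) ≤ T → 0 ≤ a ∧ a ≤ 2 * (1 / (t : ℝ) ^ α)) :
            ‖if c then a else 0‖ ≤ 2 * (1 / (t : ℝ) ^ α) := by
          split_ifs with h
          · obtain ⟨h0, h1⟩ := ha (by exact_mod_cast hc h)
            rwa [Real.norm_of_nonneg h0]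
          · rw [norm_zero]
            positivity
        calc ‖F T t‖ ≤ 2 * (1 / (t : ℝ) ^ α) + 2 * (1 / (t : ℝ) ^ α) := by
              refine (norm_add_le _ _).trans (add_le_add (hbound id fun h => ?_)
                (hbound le_of_lt fun h => ?_))
              · have : (0 : ℝ) ≤ T - t := by linarith
                exact ⟨by positivity, div_rpow_mul_sub_le ht h⟩
              · have : (0 : ℝ) ≤ T - t := by linarith
                exact ⟨by positivity, div_sub_rpow_mul_le hα.le ht h⟩
          _ = 4 * (1 / (t : ℝ) ^ α) := by ring
  exact key.congr hsum
end

section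
/- For every real constant α > 0, lim_{T→∞} Σ_{t=1}^{T−1} 1/(t^α (T−t)) = 0. -/
open Filter

lemma sum_Ico_inv_le_one_add_log (T : ℕ) :
    ∑ t ∈ Finset.Ico 1 T, ((t : ℝ))⁻¹ ≤ 1 + Real.log T := by
  refine le_trans ?_ (harmonic_le_one_add_log T)
  rw [harmonic_eq_sum_Icc]
  push_cast
  refine Finset.sum_le_sum_of_subset_of_nonneg Finset.Ico_subset_Icc_self fun t _ _ => ?_
  positivity

lemma sum_Ico_inv_sub (T : ℕ) :
    ∑ t ∈ Finset.Ico 1 T, ((T : ℝ) - t)⁻¹ = ∑ t ∈ Finset.Ico 1 T, ((t : ℝ))⁻¹ := by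
  have h := Finset.sum_Ico_reflect (fun t : ℕ => ((t : ℝ))⁻¹) 1 (Nat.le_succ T)
  simp only [Nat.add_sub_cancel_left, Nat.add_sub_cancel] at h
  rw [← h]
  refine Finset.sum_congr rfl fun t ht => ?_
  rw [Nat.cast_sub (Finset.mem_Ico.1 ht).2.le]

lemma one_div_rpow_mul_sub_le {α β x y : ℝ} (hβα : β ≤ α) (hβ : β ≤ 1) (hx : 1 ≤ x)
    (hxy : x < y) : 1 / (x ^ α * (y - x)) ≤ y ^ (-β) * (x⁻¹ + (y - x)⁻¹) := by
  have hx0 : 0 < x := by linarith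
  have hy0 : 0 < y := by linarith
  have hd : 0 < y - x := by linarith
  calc 1 / (x ^ α * (y - x)) ≤ 1 / (x ^ β * (y - x)) := by gcongr
    _ = x ^ (1 - β) * (x⁻¹ * (y - x)⁻¹) := by
      rw [Real.rpow_sub hx0, Real.rpow_one]
      field_simp
    _ ≤ y ^ (1 - β) * (x⁻¹ * (y - x)⁻¹) := by
      have := Real.rpow_le_rpow hx0.le hxy.le (sub_nonneg.2 hβ)
      gcongr
    _ = y ^ (-β) * (x⁻¹ + (y - x)⁻¹) := by
      rw [Real.rpow_sub hy0, Real.rpow_one, Real.rpow_neg hy0.le]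
      field_simp
      ring

lemma tendsto_rpow_neg_mul_one_add_log {β : ℝ} (hβ : 0 < β) :
    Tendsto (fun x : ℝ => x ^ (-β) * (2 * (1 + Real.log x))) atTop (nhds 0) := by
  have h₁ := tendsto_rpow_neg_atTop hβ
  have h₂ := (isLittleO_log_rpow_atTop hβ).tendsto_div_nhds_zero
  have h₃ := (h₁.add h₂).const_mul 2
  simp only [add_zero, mul_zero] at h₃
  refine h₃.congr' ?_
  filter_upwards [eventually_ge_atTop 0] with x hx
  rw [Real.rpow_neg hx]
  ring

/-- **Lemma 3, second part.** For every `α > 0`,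
`Σ_{t=1}^{T−1} 1/(t^α (T−t)) → 0` as `T → ∞`. -/
theorem lemma3_sum_tendsto_zero (α : ℝ) (hα : 0 < α) :
    Tendsto (fun T : ℕ =>
        ∑ t ∈ Finset.Ico 1 T, 1 / ((t : ℝ) ^ α * ((T : ℝ) - (t : ℝ))))
      atTop (nhds 0) := by
  have hβ : 0 < min α 1 := lt_min hα one_pos
  refine squeeze_zero (fun T => Finset.sum_nonneg fun t ht => ?_) (fun T => ?_)
    ((tendsto_rpow_neg_mul_one_add_log hβ).comp tendsto_natCast_atTop_atTop)
  · have : (t : ℝ) ≤ T := by exact_mod_cast (Finset.mem_Ico.1 ht).2.le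
    have := sub_nonneg.2 this
    positivity
  · calc ∑ t ∈ Finset.Ico 1 T, 1 / ((t : ℝ) ^ α * ((T : ℝ) - (t : ℝ)))
        ≤ ∑ t ∈ Finset.Ico 1 T, (T : ℝ) ^ (-min α 1) * ((t : ℝ)⁻¹ + ((T : ℝ) - t)⁻¹) := by
          refine Finset.sum_le_sum fun t ht => ?_
          obtain ⟨h₁, h₂⟩ := Finset.mem_Ico.1 ht
          exact one_div_rpow_mul_sub_le (min_le_left _ _) (min_le_right _ _)
            (by exact_mod_cast h₁) (by exact_mod_cast h₂)
      _ ≤ (T : ℝ) ^ (-min α 1) * (2 * (1 + Real.log T)) := by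
          rw [← Finset.mul_sum, Finset.sum_add_distrib, sum_Ico_inv_sub, ← two_mul]
          gcongr
          exact sum_Ico_inv_le_one_add_log T
end

section
/- Let a_0, a_1, …, a_T be real numbers in [0,1]. Then for all integers t_1, t_2 with 1 ≤ t_1 ≤ t_2 ≤ T−1, the bound −1/(T−t_2) ≤ Σ_{t=t_1}^{t_2} (a_t − a_{t−1})/(T−t) ≤ 1/(T−t_2) holds. In particular, for any sequence of policies π_0, π̂_1, …, π̂_T : X → [0,1] and any x ∈ X, |Σ_{t=t_1}^{t_2} (π̂_t(x) − π̂_{t−1}(x))/(T−t)| ≤ 1/(T−t_2). -/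
/-- Telescoping sums with increasing weights `1 / (T - t)` of a nonnegative sequence are bounded by
the last term. -/
theorem sum_sub_div_le_last (T : ℕ) (a : ℕ → ℝ) (ha : ∀ t, t ≤ T → 0 ≤ a t)
    {m n : ℕ} (hmn : m ≤ n) (hn : n < T) :
    ∑ t ∈ Finset.Icc m n, (a t - a (t - 1)) / ((T : ℝ) - (t : ℝ)) ≤
      a n / ((T : ℝ) - (n : ℝ)) := by
  induction n, hmn using Nat.le_induction with
  | base =>
    have hpos : (0 : ℝ) < (T : ℝ) - m := sub_pos.2 (by exact_mod_cast hn)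
    have hprev := ha (m - 1) (by omega)
    rw [Finset.Icc_self, Finset.sum_singleton]
    gcongr
    linarith
  | succ n hmn ih =>
    have hpos : (0 : ℝ) < (T : ℝ) - (n + 1 : ℕ) := sub_pos.2 (by exact_mod_cast hn)
    have hprev := ha n (by omega)
    have hweight : a n / ((T : ℝ) - n) ≤ a n / ((T : ℝ) - (n + 1 : ℕ)) := by
      gcongr
      omega
    rw [Finset.sum_Icc_succ_top (by omega), Nat.add_sub_cancel, sub_div]
    linarith [ih (by omega)]

/-- Telescoping sums with weights `1 / (T - t)` of a `[0, 1]`-valued sequence are bounded by the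
last weight. -/
theorem abs_sum_sub_div_le (T : ℕ) (a : ℕ → ℝ) (ha : ∀ t, t ≤ T → a t ∈ Set.Icc (0 : ℝ) 1)
    {m n : ℕ} (hmn : m ≤ n) (hn : n < T) :
    |∑ t ∈ Finset.Icc m n, (a t - a (t - 1)) / ((T : ℝ) - (t : ℝ))| ≤
      1 / ((T : ℝ) - (n : ℝ)) := by
  have hpos : (0 : ℝ) < (T : ℝ) - n := sub_pos.2 (by exact_mod_cast hn)
  obtain ⟨h0, h1⟩ := ha n hn.le
  have upper := sum_sub_div_le_last T a (fun t ht => (ha t ht).1) hmn hn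
  have lower := sum_sub_div_le_last T (fun t => 1 - a t) (fun t ht => sub_nonneg.2 (ha t ht).2)
    hmn hn
  have hneg : ∑ t ∈ Finset.Icc m n, ((1 - a t) - (1 - a (t - 1))) / ((T : ℝ) - (t : ℝ)) =
      -∑ t ∈ Finset.Icc m n, (a t - a (t - 1)) / ((T : ℝ) - (t : ℝ)) := by
    rw [← Finset.sum_neg_distrib]
    exact Finset.sum_congr rfl fun t _ => by ring
  have hle : a n / ((T : ℝ) - n) ≤ 1 / ((T : ℝ) - n) := by gcongr
  have hle' : (1 - a n) / ((T : ℝ) - n) ≤ 1 / ((T : ℝ) - n) := by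
    gcongr
    linarith
  rw [abs_le]
  constructor <;> linarith

/-- **Lemma 4 (telescoping bound).** For `a_0, …, a_T ∈ [0,1]` and all integers
`1 ≤ t_1 ≤ t_2 ≤ T − 1`,
`−1/(T−t_2) ≤ Σ_{t=t_1}^{t_2} (a_t − a_{t−1})/(T−t) ≤ 1/(T−t_2)`. In particular, for any
sequence of policies `π_0 = π̂_0, π̂_1, …, π̂_T : 𝓧 → [0,1]` and any `x`,
`|Σ_{t=t_1}^{t_2} (π̂_t(x) − π̂_{t−1}(x))/(T−t)| ≤ 1/(T−t_2)`. -/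
theorem lemma4_telescoping_bound {𝓧 : Type*} (T : ℕ) (hT : 1 ≤ T)
    (a : ℕ → ℝ) (ha : ∀ t, t ≤ T → a t ∈ Set.Icc (0 : ℝ) 1)
    (pol : ℕ → 𝓧 → ℝ) (hpol : ∀ t, t ≤ T → ∀ x, pol t x ∈ Set.Icc (0 : ℝ) 1) :
    ∀ t1 t2 : ℕ, 1 ≤ t1 → t1 ≤ t2 → t2 ≤ T - 1 →
      (-(1 / ((T : ℝ) - (t2 : ℝ))) ≤
          ∑ t ∈ Finset.Icc t1 t2, (a t - a (t - 1)) / ((T : ℝ) - (t : ℝ)) ∧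
        ∑ t ∈ Finset.Icc t1 t2, (a t - a (t - 1)) / ((T : ℝ) - (t : ℝ)) ≤
          1 / ((T : ℝ) - (t2 : ℝ))) ∧
      ∀ x : 𝓧,
        |∑ t ∈ Finset.Icc t1 t2, (pol t x - pol (t - 1) x) / ((T : ℝ) - (t : ℝ))| ≤
          1 / ((T : ℝ) - (t2 : ℝ)) := by
  intro t1 t2 _ h12 h2
  have h2T : t2 < T := by omega
  exact ⟨abs_le.1 (abs_sum_sub_div_le T a ha h12 h2T), fun x =>
    abs_sum_sub_div_le T (fun t => pol t x) (fun t ht => hpol t ht x) h12 h2T⟩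
end
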